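/- arXiv:math-ph/0512093 — 9 statements merged into one kernel-verified Lean document; each statement's English description precedes it below -/
import Mathlib

section
/- Let N be a real skew-symmetric n×n matrix and X, Z ∈ Sym(n). Then trace(ZY) = trace(X·(XNY − YNX)) holds for all Y ∈ Sym(n) if and only if Z = X²N − NX² = [X², N]. Consequently, the equations Ẋ = [X², N] are the Euler–Poincaré equations of the Lagrangian l(X) = (1/2) trace(X²) on the Lie algebra (Sym(n), [·,·]_N), since the Euler–Poincaré condition (d/dt)⟨⟨X,Y⟩⟩ = ⟨⟨X, [X,Y]_N⟩⟩ for all Y is precisely this identity with Z = Ẋ. -/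
open Matrix

/-- For skew-symmetric `N` and symmetric `X, Z`:
`trace(Z Y) = trace(X (X N Y − Y N X))` holds for all symmetric `Y`
iff `Z = X² N − N X² = [X², N]`.  Consequently `Ẋ = [X², N]` are the
Euler–Poincaré equations of the Lagrangian `l(X) = (1/2) trace(X²)` on
`(Sym(n), [·,·]_N)`, the Euler–Poincaré condition being exactly this
identity with `Z = Ẋ`. -/
theorem stmt4 (n : ℕ) (N : Matrix (Fin n) (Fin n) ℝ) (hN : Nᵀ = -N)
    (X Z : Matrix (Fin n) (Fin n) ℝ) (hX : X.IsSymm) (hZ : Z.IsSymm) :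
    (∀ Y : Matrix (Fin n) (Fin n) ℝ, Y.IsSymm →
        (Z * Y).trace = (X * (X * N * Y - Y * N * X)).trace)
      ↔ Z = X * X * N - N * (X * X) := by
  have key : ∀ Y : Matrix (Fin n) (Fin n) ℝ,
      (X * (X * N * Y - Y * N * X)).trace = ((X * X * N - N * (X * X)) * Y).trace := by
    intro Y
    have h1 : (X * (Y * N * X)).trace = (N * (X * X) * Y).trace := by
      rw [Matrix.trace_mul_comm X, Matrix.trace_mul_comm _ Y]
      simp only [Matrix.mul_assoc]
    rw [Matrix.mul_sub, Matrix.sub_mul, Matrix.trace_sub, Matrix.trace_sub, h1]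
    simp only [Matrix.mul_assoc]
  constructor
  · intro h
    have hW : (Z - (X * X * N - N * (X * X)))ᵀ = Z - (X * X * N - N * (X * X)) := by
      simp only [Matrix.transpose_sub, Matrix.transpose_mul, hN, hX.eq, hZ.eq,
        Matrix.neg_mul, Matrix.mul_neg]
      abel
    have h2 := h _ hW
    rw [key, ← sub_eq_zero, ← Matrix.trace_sub, ← Matrix.sub_mul] at h2
    rw [← sub_eq_zero]
    apply Matrix.trace_conjTranspose_mul_self_eq_zero_iff.mp
    rw [Matrix.conjTranspose_eq_transpose_of_trivial, hW]
    exact h2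
  · intro h Y _
    rw [key, ← h]
end

section
/- Let N be a real skew-symmetric n×n matrix and define the bilinear form κ_N(X,Y) := trace(NXNY) on Sym(n). Then κ_N is ad-invariant with respect to the bracket [·,·]_N: for all X, Y, Z ∈ Sym(n), κ_N([Z,X]_N, Y) + κ_N(X, [Z,Y]_N) = 0. -/
open Matrix

/-- The bilinear form `κ_N(X,Y) = trace(N X N Y)` on `Sym(n)` is ad-invariant
for the bracket `[X,Y]_N = X N Y − Y N X`:
`κ_N([Z,X]_N, Y) + κ_N(X, [Z,Y]_N) = 0`. -/
theorem stmt5 (n : ℕ) (N : Matrix (Fin n) (Fin n) ℝ) (hN : Nᵀ = -N)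
    (X Y Z : Matrix (Fin n) (Fin n) ℝ)
    (hX : X.IsSymm) (hY : Y.IsSymm) (hZ : Z.IsSymm) :
    (N * (Z * N * X - X * N * Z) * N * Y).trace
      + (N * X * N * (Z * N * Y - Y * N * Z)).trace = 0 := by
  have h := Matrix.trace_mul_comm (N * Z) (N * X * N * Y)
  simp only [Matrix.mul_sub, Matrix.sub_mul, Matrix.trace_sub, ← Matrix.mul_assoc] at h ⊢
  linarith
end

section
/- Let N̄ be a real skew-symmetric (2p)×(2p) matrix, let d ≥ 0, set n = 2p + d, and let N be the n×n block matrix with blocks [[N̄, 0],[0, 0]]. Define Ψ(S, A, B) to be the n×n symmetric block matrix [[S, A],[Aᵀ, B]] for S ∈ Sym(2p), A a (2p)×d real matrix, and B ∈ Sym(d). Then Ψ is a linear bijection onto Sym(n), and for all such triples, [Ψ(S,A,B), Ψ(S',A',B')]_N = Ψ(S N̄ S' − S' N̄ S, S N̄ A' − S' N̄ A, Aᵀ N̄ A' − (A')ᵀ N̄ A); i.e., Ψ is a Lie algebra isomorphism from the central extension by the cocycle C((S,A),(S',A')) = Aᵀ N̄ A' − (A')ᵀ N̄ A of the semidirect product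 Sym(2p) ⋉ M_{(2p)×d} onto (Sym(n), [·,·]_N). -/
open Matrix

/-- With `N = [[N̄, 0],[0,0]]` for a skew-symmetric `(2p)×(2p)` matrix `N̄`,
the map `Ψ(S,A,B) = [[S, A],[Aᵀ, B]]` is a linear bijection onto `Sym(n)`
(`n = 2p + d`) and satisfies
`[Ψ(S,A,B), Ψ(S',A',B')]_N
   = Ψ(S N̄ S' − S' N̄ S, S N̄ A' − S' N̄ A, Aᵀ N̄ A' − A'ᵀ N̄ A)`;
i.e. `Ψ` is a Lie algebra isomorphism from the cocycle central extension of the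
semidirect product `Sym(2p) ⋉ M_{(2p)×d}` onto `(Sym(n), [·,·]_N)`. -/
theorem stmt6 (p d : ℕ) (Nb : Matrix (Fin (2 * p)) (Fin (2 * p)) ℝ)
    (hNb : Nbᵀ = -Nb) :
    -- injectivity of Ψ
    (∀ (S S' : Matrix (Fin (2 * p)) (Fin (2 * p)) ℝ)
       (A A' : Matrix (Fin (2 * p)) (Fin d) ℝ)
       (B B' : Matrix (Fin d) (Fin d) ℝ),
      fromBlocks S A Aᵀ B = fromBlocks S' A' A'ᵀ B' →
        S = S' ∧ A = A' ∧ B = B') ∧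
    -- Ψ takes values in Sym(n)
    (∀ (S : Matrix (Fin (2 * p)) (Fin (2 * p)) ℝ)
       (A : Matrix (Fin (2 * p)) (Fin d) ℝ)
       (B : Matrix (Fin d) (Fin d) ℝ),
      S.IsSymm → B.IsSymm → (fromBlocks S A Aᵀ B).IsSymm) ∧
    -- Ψ is onto Sym(n)
    (∀ X : Matrix (Fin (2 * p) ⊕ Fin d) (Fin (2 * p) ⊕ Fin d) ℝ, X.IsSymm →
      ∃ (S : Matrix (Fin (2 * p)) (Fin (2 * p)) ℝ)
        (A : Matrix (Fin (2 * p)) (Fin d) ℝ)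
        (B : Matrix (Fin d) (Fin d) ℝ),
        S.IsSymm ∧ B.IsSymm ∧ X = fromBlocks S A Aᵀ B) ∧
    -- Ψ intertwines the extended bracket with [·,·]_N
    (∀ (S S' : Matrix (Fin (2 * p)) (Fin (2 * p)) ℝ)
       (A A' : Matrix (Fin (2 * p)) (Fin d) ℝ)
       (B B' : Matrix (Fin d) (Fin d) ℝ),
      S.IsSymm → S'.IsSymm → B.IsSymm → B'.IsSymm →
      fromBlocks S A Aᵀ B * fromBlocks Nb 0 0 0 * fromBlocks S' A' A'ᵀ B'
        - fromBlocks S' A' A'ᵀ B' * fromBlocks Nb 0 0 0 * fromBlocks S A Aᵀ B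
      = fromBlocks (S * Nb * S' - S' * Nb * S) (S * Nb * A' - S' * Nb * A)
          (S * Nb * A' - S' * Nb * A)ᵀ (Aᵀ * Nb * A' - A'ᵀ * Nb * A)) := by
  refine ⟨?_, ?_, ?_, ?_⟩
  · intro S S' A A' B B' h
    rw [fromBlocks_inj] at h
    exact ⟨h.1, h.2.1, h.2.2.2⟩
  · intro S A B hS hB
    exact IsSymm.fromBlocks hS rfl hB
  · intro X hX
    refine ⟨X.toBlocks₁₁, X.toBlocks₁₂, X.toBlocks₂₂, ?_, ?_, ?_⟩
    · ext i j
      exact hX.apply (Sum.inl i) (Sum.inl j)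
    · ext i j
      exact hX.apply (Sum.inr i) (Sum.inr j)
    · have h : X.toBlocks₁₂ᵀ = X.toBlocks₂₁ := by
        ext i j
        exact hX.apply (Sum.inr i) (Sum.inl j)
      rw [h, fromBlocks_toBlocks]
  · intro S S' A A' B B' hS hS' hB hB'
    have e : (S * Nb * A' - S' * Nb * A)ᵀ = Aᵀ * Nb * S' - A'ᵀ * Nb * S := by
      rw [transpose_sub, transpose_mul, transpose_mul, transpose_mul, transpose_mul,
        hS.eq, hS'.eq, hNb]
      simp only [Matrix.neg_mul, Matrix.mul_neg, Matrix.mul_assoc]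
      abel
    rw [e]
    simp [fromBlocks_multiply, sub_eq_add_neg, fromBlocks_neg, fromBlocks_add]
end

section
/- Let N̄ be an invertible real skew-symmetric (2p)×(2p) matrix, let d ≥ 1, n = 2p + d, and let N = [[N̄,0],[0,0]] in block form. Let X = [[S, A],[Aᵀ, B]] ∈ Sym(n) with S ∈ Sym(2p), A a (2p)×d matrix, and B ∈ Sym(d) invertible. Then a symmetric matrix Y = [[U, C],[Cᵀ, D]] (U ∈ Sym(2p), C a (2p)×d matrix, D ∈ Sym(d)) satisfies XYN = NYX if and only if C = −UAB⁻¹ and (S − AB⁻¹Aᵀ) U N̄ = N̄ U (S − AB⁻¹Aᵀ); the block D is arbitrary. -/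
open Matrix

/-- Kernel of the Lie–Poisson tensor `B_X(Y) = XYN − NYX` at a generic point:
for `N = [[N̄,0],[0,0]]` with `N̄` invertible skew-symmetric,
`X = [[S,A],[Aᵀ,B]]` symmetric with `B` invertible, a symmetric
`Y = [[U,C],[Cᵀ,D]]` satisfies `XYN = NYX` iff `C = −U A B⁻¹` and
`(S − A B⁻¹ Aᵀ) U N̄ = N̄ U (S − A B⁻¹ Aᵀ)`; the block `D` is arbitrary. -/
theorem stmt8 (p d : ℕ) (hd : 1 ≤ d)
    (Nb : Matrix (Fin (2 * p)) (Fin (2 * p)) ℝ)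
    (hNb : Nbᵀ = -Nb) (hNbdet : IsUnit Nb.det)
    (S : Matrix (Fin (2 * p)) (Fin (2 * p)) ℝ) (hS : S.IsSymm)
    (A : Matrix (Fin (2 * p)) (Fin d) ℝ)
    (B : Matrix (Fin d) (Fin d) ℝ) (hB : B.IsSymm) (hBdet : IsUnit B.det)
    (U : Matrix (Fin (2 * p)) (Fin (2 * p)) ℝ) (hU : U.IsSymm)
    (C : Matrix (Fin (2 * p)) (Fin d) ℝ)
    (D : Matrix (Fin d) (Fin d) ℝ) (hD : D.IsSymm) :
    fromBlocks S A Aᵀ B * fromBlocks U C Cᵀ D * fromBlocks Nb 0 0 0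
        = fromBlocks Nb 0 0 0 * fromBlocks U C Cᵀ D * fromBlocks S A Aᵀ B
      ↔ (C = -(U * A * B⁻¹) ∧
          (S - A * B⁻¹ * Aᵀ) * U * Nb = Nb * U * (S - A * B⁻¹ * Aᵀ)) := by
  have hBi : (B⁻¹)ᵀ = B⁻¹ := by rw [transpose_nonsing_inv, hB.eq]
  have hBB : B * B⁻¹ = 1 := mul_nonsing_inv B hBdet
  have hBB' : B⁻¹ * B = 1 := nonsing_inv_mul B hBdet
  have hNN : Nb⁻¹ * Nb = 1 := nonsing_inv_mul Nb hNbdet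
  have key : ∀ hC : C = -(U * A * B⁻¹), Cᵀ = -(B⁻¹ * Aᵀ * U) := by
    intro hC
    rw [hC, transpose_neg, transpose_mul, transpose_mul, hBi, hU.eq, Matrix.mul_assoc]
  have e1 : C = -(U * A * B⁻¹) →
      (S * U + A * Cᵀ) * Nb = (S - A * B⁻¹ * Aᵀ) * U * Nb := by
    intro hC
    rw [key hC]
    simp only [Matrix.add_mul, Matrix.neg_mul, Matrix.mul_neg, Matrix.mul_assoc, sub_eq_add_neg]
  have e2 : C = -(U * A * B⁻¹) →
      Nb * U * S + Nb * C * Aᵀ = Nb * U * (S - A * B⁻¹ * Aᵀ) := by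
    intro hC
    rw [hC]
    simp only [Matrix.mul_add, Matrix.mul_neg, Matrix.neg_mul, Matrix.mul_assoc, sub_eq_add_neg]
  simp only [fromBlocks_multiply, Matrix.mul_zero, Matrix.zero_mul, add_zero, fromBlocks_inj]
  constructor
  · rintro ⟨h11, h12, -, -⟩
    have hC : C = -(U * A * B⁻¹) := by
      have h1 : U * A + C * B = 0 := by
        have := congrArg (fun M => Nb⁻¹ * M) h12
        simp only [Matrix.mul_zero, Matrix.mul_add, ← Matrix.mul_assoc, hNN,
          Matrix.one_mul] at this
        exact this.symm
      have h2 := congrArg (fun M => M * B⁻¹) h1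
      simp only [Matrix.add_mul, Matrix.zero_mul, Matrix.mul_assoc C, hBB, Matrix.mul_one] at h2
      exact (neg_eq_of_add_eq_zero_right h2).symm
    exact ⟨hC, by rw [← e1 hC, ← e2 hC]; exact h11⟩
  · rintro ⟨hC, h⟩
    refine ⟨?_, ?_, ?_, ?_⟩
    · rw [e1 hC, e2 hC]; exact h
    · rw [hC]
      simp only [Matrix.mul_neg, Matrix.neg_mul, Matrix.mul_assoc, hBB', Matrix.mul_one,
        add_neg_cancel]
    · rw [key hC]
      simp only [Matrix.mul_neg, ← Matrix.mul_assoc, hBB, Matrix.one_mul,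
        add_neg_cancel, Matrix.zero_mul]
    · trivial
end

section
/- Let p ≥ 1, d ≥ 0, n = 2p + d, and let N be the n×n real skew-symmetric matrix in block form [[0, V, 0],[−V, 0, 0],[0, 0, 0]] where V = diag(v₁, …, v_p) with all v_i nonzero and v_i² ≠ v_j² for i ≠ j. Then the real vector space { Y ∈ Sym(n) : YN = NY } has dimension p + d(d+1)/2. Consequently, every symplectic leaf of the frozen Poisson structure with tensor C_X(Y) = YN − NY is 2p(p+d)-dimensional. -/
open Matrix

theorem finrank_sym_aux (ι : Type) [Fintype ι] [DecidableEq ι] :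
    Module.finrank ℝ ↥(LinearMap.ker
      ((transposeLinearEquiv ι ι ℝ ℝ).toLinearMap - LinearMap.id)) =
      (Fintype.card ι + 1).choose 2 := by
  let g : (Sym2 ι → ℝ) →ₗ[ℝ] Matrix ι ι ℝ :=
    { toFun := fun s => Matrix.of fun i j => s s(i, j)
      map_add' := by intro x y; ext i j; simp
      map_smul' := by intro c x; ext i j; simp }
  have hg : Function.Injective g := by
    intro x y h
    funext s
    induction s using Sym2.ind with
    | _ i j => exact congrFun (congrFun h i) j
  have hr : LinearMap.range g = LinearMap.ker
      ((transposeLinearEquiv ι ι ℝ ℝ).toLinearMap - LinearMap.id) := by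
    ext Y
    simp only [LinearMap.mem_range, LinearMap.mem_ker, LinearMap.sub_apply, sub_eq_zero]
    constructor
    · rintro ⟨s, rfl⟩
      ext i j
      simp [g, Sym2.eq_swap]
    · intro h
      have h' : ∀ i j, Y i j = Y j i := fun i j => (congrFun (congrFun h j) i)
      exact ⟨Sym2.lift ⟨fun i j => Y i j, h'⟩, by ext i j; simp [g]⟩
  rw [← hr, LinearMap.finrank_range_of_inj hg, Module.finrank_fintype_fun_eq_card, Sym2.card]

set_option maxHeartbeats 1000000 in
theorem finrank_ker_aux (p d : ℕ) (v : Fin p → ℝ)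
    (hv : ∀ i, v i ≠ 0) (hv2 : ∀ i j, i ≠ j → v i ^ 2 ≠ v j ^ 2)
    (N : Matrix ((Fin p ⊕ Fin p) ⊕ Fin d) ((Fin p ⊕ Fin p) ⊕ Fin d) ℝ)
    (hN : N = fromBlocks (fromBlocks 0 (diagonal v) (-(diagonal v)) 0) 0 0 0) :
    Module.finrank ℝ
        ↥(LinearMap.ker
            ((transposeLinearEquiv ((Fin p ⊕ Fin p) ⊕ Fin d)
                ((Fin p ⊕ Fin p) ⊕ Fin d) ℝ ℝ).toLinearMap - LinearMap.id)
          ⊓ LinearMap.ker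
              (LinearMap.mulRight ℝ N - LinearMap.mulLeft ℝ N))
        = p + (d + 1).choose 2 := by
  let g : ((Fin p → ℝ) × (Sym2 (Fin d) → ℝ)) →ₗ[ℝ]
      Matrix ((Fin p ⊕ Fin p) ⊕ Fin d) ((Fin p ⊕ Fin p) ⊕ Fin d) ℝ :=
    { toFun := fun s => fromBlocks (fromBlocks (diagonal s.1) 0 0 (diagonal s.1)) 0 0
        (Matrix.of fun i j => s.2 s(i, j))
      map_add' := by
        rintro x y; ext ((i | i) | i) ((j | j) | j) <;> simp [diagonal_apply]
        all_goals split_ifs <;> simp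
      map_smul' := by
        rintro x y; ext ((i | i) | i) ((j | j) | j) <;> simp [diagonal_apply] }
  have hg : Function.Injective g := by
    rintro ⟨x, s⟩ ⟨y, t⟩ h
    ext a
    · simpa [g] using congrFun (congrFun h (.inl (.inl a))) (.inl (.inl a))
    · induction a using Sym2.ind with
      | _ i j => exact congrFun (congrFun h (.inr i)) (.inr j)
  have hr : LinearMap.range g = LinearMap.ker
            ((transposeLinearEquiv ((Fin p ⊕ Fin p) ⊕ Fin d)
                ((Fin p ⊕ Fin p) ⊕ Fin d) ℝ ℝ).toLinearMap - LinearMap.id)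
          ⊓ LinearMap.ker
              (LinearMap.mulRight ℝ N - LinearMap.mulLeft ℝ N) := by
    ext Y
    simp only [LinearMap.mem_range, Submodule.mem_inf, LinearMap.mem_ker, LinearMap.sub_apply,
      sub_eq_zero, LinearMap.mulRight_apply, LinearMap.mulLeft_apply]
    constructor
    · rintro ⟨⟨x, s⟩, rfl⟩
      refine ⟨?_, ?_⟩
      · ext ((i | i) | i) ((j | j) | j) <;> simp [g, Sym2.eq_swap, diagonal_apply]
        all_goals grind
      · subst hN
        simp [g, fromBlocks_multiply, -fromBlocks_diagonal, mul_comm]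
    · rintro ⟨h, h2⟩
      have h' : ∀ i j, Y i j = Y j i := fun i j => (congrFun (congrFun h j) i)
      have e : ∀ i j, (Y * N) i j = (N * Y) i j := fun i j => by rw [h2]
      subst hN
      have e11 := fun i j => e (.inl (.inl i)) (.inl (.inl j))
      have e12 := fun i j => e (.inl (.inl i)) (.inl (.inr j))
      have e21 := fun i j => e (.inl (.inr i)) (.inl (.inl j))
      have e22 := fun i j => e (.inl (.inr i)) (.inl (.inr j))
      have e31 := fun i j => e (.inr i) (.inl (.inl j))
      have e32 := fun i j => e (.inr i) (.inl (.inr j))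
      simp [Matrix.mul_apply, Fintype.sum_sum_type, diagonal_apply] at e11 e12 e21 e22 e31 e32
      have E : ∀ i j, Y (.inr i) (.inl (.inl j)) = 0 := by
        intro i j; have := e32 i j; have := hv j; grind
      have F : ∀ i j, Y (.inr i) (.inl (.inr j)) = 0 := by
        intro i j; have := e31 i j; have := hv j; grind
      have A : ∀ i j, i ≠ j → Y (.inl (.inl i)) (.inl (.inl j)) = 0 := by
        intro i j hij
        have h1 := e12 i j
        have h2 := e21 i j
        have h3 : (v i ^ 2 - v j ^ 2) * Y (.inl (.inl i)) (.inl (.inl j)) = 0 := by grind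
        exact (mul_eq_zero.1 h3).resolve_left (sub_ne_zero.2 (hv2 i j hij))
      have C : ∀ i j, Y (.inl (.inr i)) (.inl (.inr j)) = Y (.inl (.inl i)) (.inl (.inl j)) := by
        intro i j
        have h1 := e12 i j
        have h2 := hv i
        by_cases hij : i = j
        · subst hij
          apply mul_left_cancel₀ h2
          grind
        · have := A i j hij
          grind
      have B : ∀ i j, Y (.inl (.inl i)) (.inl (.inr j)) = 0 := by
        intro i j
        have h1 := e11 i j
        have h2 := e22 i j
        have h4 := h' (.inl (.inl j)) (.inl (.inr i))
        have h5 := hv i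
        by_cases hij : i = j
        · subst hij
          have : v i * Y (.inl (.inl i)) (.inl (.inr i)) = 0 := by grind
          exact (mul_eq_zero.1 this).resolve_left h5
        · have h3 : (v i ^ 2 - v j ^ 2) * Y (.inl (.inl i)) (.inl (.inr j)) = 0 := by grind
          exact (mul_eq_zero.1 h3).resolve_left (sub_ne_zero.2 (hv2 i j hij))
      refine ⟨(fun i => Y (.inl (.inl i)) (.inl (.inl i)),
        Sym2.lift ⟨fun i j => Y (.inr i) (.inr j), fun i j => h' _ _⟩), ?_⟩
      have E' : ∀ i j, Y (.inl (.inl j)) (.inr i) = 0 := fun i j => (h' _ _).trans (E i j)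
      have F' : ∀ i j, Y (.inl (.inr j)) (.inr i) = 0 := fun i j => (h' _ _).trans (F i j)
      have B' : ∀ i j, Y (.inl (.inr j)) (.inl (.inl i)) = 0 := fun i j => (h' _ _).trans (B i j)
      clear e e11 e12 e21 e22 e31 e32 h h2 hv hv2
      ext ((i | i) | i) ((j | j) | j) <;> simp [g, diagonal_apply, E, F, B, C, E', F', B']
      all_goals
        intros
        by_cases hij : i = j
        · subst hij; simp
        · simp [hij, A i j hij]
  rw [← hr, LinearMap.finrank_range_of_inj hg, Module.finrank_prod,
    Module.finrank_fintype_fun_eq_card, Module.finrank_fintype_fun_eq_card, Sym2.card]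
  simp

theorem finrank_map_aux {E F : Type*} [AddCommGroup E] [Module ℝ E] [FiniteDimensional ℝ E]
    [AddCommGroup F] [Module ℝ F] (f : E →ₗ[ℝ] F) (S : Submodule ℝ E) :
    Module.finrank ℝ ↥(S.map f) + Module.finrank ℝ ↥(S ⊓ LinearMap.ker f) =
      Module.finrank ℝ S := by
  have h := LinearMap.finrank_range_add_finrank_ker (f.domRestrict S)
  rw [LinearMap.range_domRestrict, LinearMap.ker_domRestrict] at h
  rw [← h, ← Submodule.finrank_map_subtype_eq S, Submodule.map_comap_subtype]

/-- For `N = [[0,V,0],[−V,0,0],[0,0,0]]` with `V = diag(v₁,…,v_p)`, all `vᵢ ≠ 0`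
and `vᵢ² ≠ vⱼ²` for `i ≠ j`, the space `{Y ∈ Sym(n) : YN = NY}` (the kernel of
the frozen Poisson tensor `C_X(Y) = YN − NY`) has dimension `p + d(d+1)/2`;
consequently, every symplectic leaf of the frozen Poisson structure, whose
dimension is the rank of `C_X` on `Sym(n)`, is `2p(p+d)`-dimensional. -/
theorem stmt9 (p d : ℕ) (hp : 1 ≤ p) (v : Fin p → ℝ)
    (hv : ∀ i, v i ≠ 0) (hv2 : ∀ i j, i ≠ j → v i ^ 2 ≠ v j ^ 2)
    (N : Matrix ((Fin p ⊕ Fin p) ⊕ Fin d) ((Fin p ⊕ Fin p) ⊕ Fin d) ℝ)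
    (hN : N = fromBlocks (fromBlocks 0 (diagonal v) (-(diagonal v)) 0) 0 0 0) :
    Module.finrank ℝ
        ↥(LinearMap.ker
            ((transposeLinearEquiv ((Fin p ⊕ Fin p) ⊕ Fin d)
                ((Fin p ⊕ Fin p) ⊕ Fin d) ℝ ℝ).toLinearMap - LinearMap.id)
          ⊓ LinearMap.ker
              (LinearMap.mulRight ℝ N - LinearMap.mulLeft ℝ N))
        = p + d * (d + 1) / 2 ∧
    Module.finrank ℝ
        ↥(Submodule.map (LinearMap.mulRight ℝ N - LinearMap.mulLeft ℝ N)
            (LinearMap.ker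
              ((transposeLinearEquiv ((Fin p ⊕ Fin p) ⊕ Fin d)
                  ((Fin p ⊕ Fin p) ⊕ Fin d) ℝ ℝ).toLinearMap - LinearMap.id)))
        = 2 * p * (p + d) := by
  have hk := finrank_ker_aux p d v hv hv2 N hN
  have hs := finrank_sym_aux ((Fin p ⊕ Fin p) ⊕ Fin d)
  have hm := finrank_map_aux (LinearMap.mulRight ℝ N - LinearMap.mulLeft ℝ N) (LinearMap.ker
            ((transposeLinearEquiv ((Fin p ⊕ Fin p) ⊕ Fin d)
                ((Fin p ⊕ Fin p) ⊕ Fin d) ℝ ℝ).toLinearMap - LinearMap.id))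
  refine ⟨?_, ?_⟩
  · rw [hk, Nat.choose_two_right, Nat.add_sub_cancel, mul_comm]
  · rw [hs, hk] at hm
    simp only [Fintype.card_sum, Fintype.card_fin] at hm
    have c : ∀ n : ℕ, 2 * (n + 1).choose 2 = n * (n + 1) := by
      intro n
      rw [Nat.choose_two_right, Nat.add_sub_cancel, mul_comm (n + 1)]
      exact Nat.two_mul_div_two_of_even (Nat.even_mul_succ_self n)
    have c1 := c (p + p + d)
    have c2 := c d
    nlinarith
end

section
/- For any n×n real matrices X and N and any real parameter λ, [X + λN, NX + XN + λN²] = [X², N]. Equivalently, the coefficient of λ in the expansion of the left-hand side, namely [N, NX+XN] + [X, N²], vanishes identically, the coefficient of λ², namely [N, N²], vanishes, and the constant term [X, NX+XN] equals [X², N]. Consequently, a curve X(t) satisfies Ẋ = [X², N] if and only if (d/dt)(X + λN) = [X + λN, NX + XN + λN²] for all λ. -/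
open Matrix

/-- Lax pair with parameter: for any `n × n` real matrices `X, N` and any
`λ ∈ ℝ`, `[X + λN, NX + XN + λN²] = [X², N]`; the coefficient of `λ`,
`[N, NX+XN] + [X, N²]`, vanishes, the coefficient of `λ²`, `[N, N²]`,
vanishes, and the constant term `[X, NX+XN]` equals `[X², N]`.  Consequently
a curve `X(t)` satisfies `Ẋ = [X², N]` iff
`(d/dt)(X + λN) = [X + λN, NX + XN + λN²]` for all `λ`. -/
theorem stmt13 (n : ℕ) (N : Matrix (Fin n) (Fin n) ℝ) :
    (∀ (X : Matrix (Fin n) (Fin n) ℝ) (lam : ℝ),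
      (X + lam • N) * (N * X + X * N + lam • (N * N))
          - (N * X + X * N + lam • (N * N)) * (X + lam • N)
        = X * X * N - N * (X * X)) ∧
    (∀ X : Matrix (Fin n) (Fin n) ℝ,
      (N * (N * X + X * N) - (N * X + X * N) * N)
        + (X * (N * N) - N * N * X) = 0) ∧
    (N * (N * N) - N * N * N = 0) ∧
    (∀ X : Matrix (Fin n) (Fin n) ℝ,
      X * (N * X + X * N) - (N * X + X * N) * X = X * X * N - N * (X * X)) ∧
    (∀ X : ℝ → Matrix (Fin n) (Fin n) ℝ,
      (∀ (t : ℝ) (i j : Fin n),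
          HasDerivAt (fun s => X s i j)
            ((X t * X t * N - N * (X t * X t)) i j) t)
        ↔ (∀ (lam t : ℝ) (i j : Fin n),
            HasDerivAt (fun s => (X s + lam • N) i j)
              (((X t + lam • N) * (N * X t + X t * N + lam • (N * N))
                - (N * X t + X t * N + lam • (N * N)) * (X t + lam • N)) i j)
              t)) := by
  have key : ∀ (X : Matrix (Fin n) (Fin n) ℝ) (lam : ℝ),
      (X + lam • N) * (N * X + X * N + lam • (N * N))
          - (N * X + X * N + lam • (N * N)) * (X + lam • N)
        = X * X * N - N * (X * X) := by
    intro X lam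
    simp only [mul_add, add_mul, smul_mul_assoc, mul_smul_comm, smul_add, mul_assoc]
    abel
  refine ⟨key, ?_, ?_, ?_, ?_⟩
  · intro X
    noncomm_ring
  · noncomm_ring
  · intro X
    noncomm_ring
  · intro X
    simp only [key]
    constructor
    · intro h lam t i j
      exact (h t i j).add_const ((lam • N) i j)
    · intro h t i j
      simpa using h 0 t i j
end

section
/- Let X, Y be real symmetric n×n matrices, N a real skew-symmetric n×n matrix, λ ∈ ℝ, and k ≥ 1 an integer. Then trace((X + λN)^{k−1} Y) = (1/2) trace( ((X + λN)^{k−1} + (X − λN)^{k−1}) Y ). Consequently, the gradient with respect to the trace inner product on Sym(n) of the function h_k^λ(X) = (1/k) trace((X + λN)^k) is ∇h_k^λ(X) = (1/2)(X + λN)^{k−1} + (1/2)(X − λN)^{k−1}, which is a symmetric matrix. -/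
open Matrix

lemma aux_congr {f g : ℝ → ℝ} {a b x : ℝ} (h : HasDerivAt f a x) (h1 : g = f) (h2 : b = a) :
    HasDerivAt g b x := by
  subst h1 h2
  exact h

lemma aux_deriv {n : ℕ} (A Y : Matrix (Fin n) (Fin n) ℝ) (k : ℕ) :
    ∃ D : Matrix (Fin n) (Fin n) ℝ,
      (∀ i j, HasDerivAt (fun t : ℝ => ((A + t • Y) ^ (k + 1)) i j) (D i j) 0) ∧
      ∀ m : ℕ, (D * A ^ m).trace = ((k : ℝ) + 1) * (A ^ (k + m) * Y).trace := by
  have h1 : ∀ i j, HasDerivAt (fun t : ℝ => (A + t • Y) i j) (Y i j) 0 := by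
    intro i j
    simpa using ((hasDerivAt_id (0 : ℝ)).mul_const (Y i j)).const_add (A i j)
  induction k with
  | zero =>
    refine ⟨Y, ?_, ?_⟩
    · simpa using h1
    · intro m
      rw [Matrix.trace_mul_comm]
      simp
  | succ k ih =>
    obtain ⟨D, hD, hT⟩ := ih
    refine ⟨D * A + A ^ (k + 1) * Y, ?_, ?_⟩
    · intro i j
      have := HasDerivAt.fun_sum (u := Finset.univ) (fun l _ => (hD i l).mul (h1 l j))
      refine aux_congr this ?_ ?_
      · funext t
        rw [pow_succ, Matrix.mul_apply]
        simp
      · simp [Matrix.mul_apply, Finset.sum_add_distrib]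
    · intro m
      have e : (A ^ (k + 1) * Y * A ^ m).trace = (A ^ (k + 1 + m) * Y).trace := by
        rw [Matrix.trace_mul_comm, ← mul_assoc, ← pow_add, add_comm m]
      rw [add_mul, Matrix.trace_add, e, mul_assoc, ← pow_succ', hT,
        show k + (m + 1) = k + 1 + m by ring]
      push_cast
      ring

/-- For symmetric `X, Y`, skew-symmetric `N`, `λ ∈ ℝ` and `k ≥ 1`:
`trace((X+λN)^{k−1} Y) = (1/2) trace(((X+λN)^{k−1} + (X−λN)^{k−1}) Y)`.
Consequently the gradient of `h_k^λ(X) = (1/k) trace((X+λN)^k)` with respect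
to the trace inner product on `Sym(n)` is
`∇h_k^λ(X) = (1/2)(X+λN)^{k−1} + (1/2)(X−λN)^{k−1}`: this matrix is symmetric
and represents the directional derivative of `h_k^λ` along every symmetric
direction `Y`. -/
theorem stmt16 (n : ℕ) (N : Matrix (Fin n) (Fin n) ℝ) (hN : Nᵀ = -N)
    (X : Matrix (Fin n) (Fin n) ℝ) (hX : X.IsSymm)
    (lam : ℝ) (k : ℕ) (hk : 1 ≤ k) :
    (∀ Y : Matrix (Fin n) (Fin n) ℝ, Y.IsSymm →
      ((X + lam • N) ^ (k - 1) * Y).trace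
        = (1 / 2 : ℝ)
            * ((((X + lam • N) ^ (k - 1) + (X - lam • N) ^ (k - 1)) * Y).trace)) ∧
    ((1 / 2 : ℝ) • (X + lam • N) ^ (k - 1)
        + (1 / 2 : ℝ) • (X - lam • N) ^ (k - 1)).IsSymm ∧
    (∀ Y : Matrix (Fin n) (Fin n) ℝ, Y.IsSymm →
      HasDerivAt (fun t : ℝ => (1 / k : ℝ) * ((X + t • Y + lam • N) ^ k).trace)
        ((((1 / 2 : ℝ) • (X + lam • N) ^ (k - 1)
            + (1 / 2 : ℝ) • (X - lam • N) ^ (k - 1)) * Y).trace) 0) := by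
  have tp : ((X + lam • N) ^ (k - 1))ᵀ = (X - lam • N) ^ (k - 1) := by
    rw [Matrix.transpose_pow, Matrix.transpose_add, Matrix.transpose_smul, hN, hX.eq, smul_neg,
      sub_eq_add_neg]
  have tm : ((X - lam • N) ^ (k - 1))ᵀ = (X + lam • N) ^ (k - 1) := by
    rw [← tp, Matrix.transpose_transpose]
  have first : ∀ Y : Matrix (Fin n) (Fin n) ℝ, Y.IsSymm →
      ((X + lam • N) ^ (k - 1) * Y).trace
        = (1 / 2 : ℝ)
            * ((((X + lam • N) ^ (k - 1) + (X - lam • N) ^ (k - 1)) * Y).trace) := by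
    intro Y hY
    have e : ((X - lam • N) ^ (k - 1) * Y).trace = ((X + lam • N) ^ (k - 1) * Y).trace := by
      rw [← Matrix.trace_transpose, Matrix.transpose_mul, tm, hY.eq, Matrix.trace_mul_comm]
    rw [add_mul, Matrix.trace_add, e]
    ring
  refine ⟨first, ?_, ?_⟩
  · rw [Matrix.IsSymm, Matrix.transpose_add, Matrix.transpose_smul, Matrix.transpose_smul, tp, tm,
      add_comm]
  · intro Y hY
    rw [← smul_add, Matrix.smul_mul, Matrix.trace_smul, smul_eq_mul, ← first Y hY]
    obtain ⟨k, rfl⟩ : ∃ l, k = l + 1 := ⟨k - 1, by omega⟩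
    obtain ⟨D, hD, hT⟩ := aux_deriv (X + lam • N) Y k
    have h := (HasDerivAt.fun_sum (u := Finset.univ) (fun l _ => hD l l)).const_mul
      (1 / ((k + 1 : ℕ) : ℝ))
    have h0 := hT 0
    refine aux_congr h ?_ ?_
    · funext t
      rw [add_right_comm]
      rfl
    · rw [pow_zero, mul_one, add_zero] at h0
      change _ = _ * D.trace
      rw [h0, Nat.add_sub_cancel]
      push_cast
      field_simp
end

section
/- Let X be a real symmetric n×n matrix, N a real skew-symmetric n×n matrix, and λ ∈ ℝ. For k ≥ 1 set G_k := (1/2)(X + λN)^{k−1} + (1/2)(X − λN)^{k−1}. Then for every k ≥ 1, X G_k N − N G_k X = G_{k+1} N − N G_{k+1}. In other words, B_X(∇h_k^λ(X)) = C_X(∇h_{k+1}^λ(X)), where B_X(Y) = XYN − NYX and C_X(Y) = YN − NY are the Lie–Poisson and frozen Poisson tensors and ∇h_k^λ(X) = G_k is the gradient of h_k^λ(X) = (1/k) trace((X + λN)^k). -/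
open Matrix

theorem stmt17_aux (n : ℕ) (N X : Matrix (Fin n) (Fin n) ℝ) (l : ℝ) (m : ℕ) :
    X * (X + l • N) ^ m * N - N * (X + l • N) ^ m * X
      = (X + l • N) ^ (m + 1) * N - N * (X + l • N) ^ (m + 1) := by
  have h1 : (X + l • N) ^ (m + 1) * N = X * (X + l • N) ^ m * N
      + l • (N * (X + l • N) ^ m * N) := by
    rw [pow_succ', add_mul, add_mul, smul_mul_assoc, smul_mul_assoc]
  have h2 : N * (X + l • N) ^ (m + 1) = N * (X + l • N) ^ m * X
      + l • (N * (X + l • N) ^ m * N) := by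
    rw [pow_succ, ← mul_assoc, mul_add, mul_smul_comm]
  rw [h1, h2]
  abel

/-- The bi-Hamiltonian recursion: for symmetric `X`, skew-symmetric `N`,
`λ ∈ ℝ`, and `G_k = (1/2)(X+λN)^{k−1} + (1/2)(X−λN)^{k−1}` (the gradient of
`h_k^λ(X) = (1/k) trace((X+λN)^k)`), one has for every `k ≥ 1`
`X G_k N − N G_k X = G_{k+1} N − N G_{k+1}`, i.e.
`B_X(∇h_k^λ(X)) = C_X(∇h_{k+1}^λ(X))` where `B_X(Y) = XYN − NYX` and
`C_X(Y) = YN − NY`. -/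
theorem stmt17 (n : ℕ) (N : Matrix (Fin n) (Fin n) ℝ) (hN : Nᵀ = -N)
    (X : Matrix (Fin n) (Fin n) ℝ) (hX : X.IsSymm)
    (lam : ℝ) (k : ℕ) (hk : 1 ≤ k) :
    X * ((1 / 2 : ℝ) • (X + lam • N) ^ (k - 1)
          + (1 / 2 : ℝ) • (X - lam • N) ^ (k - 1)) * N
      - N * ((1 / 2 : ℝ) • (X + lam • N) ^ (k - 1)
          + (1 / 2 : ℝ) • (X - lam • N) ^ (k - 1)) * X
    = ((1 / 2 : ℝ) • (X + lam • N) ^ k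
          + (1 / 2 : ℝ) • (X - lam • N) ^ k) * N
      - N * ((1 / 2 : ℝ) • (X + lam • N) ^ k
          + (1 / 2 : ℝ) • (X - lam • N) ^ k) := by
  obtain ⟨m, rfl⟩ : ∃ m, k = m + 1 := ⟨k - 1, by omega⟩
  have h1 := stmt17_aux n N X lam m
  have h2 := stmt17_aux n N X (-lam) m
  rw [neg_smul, ← sub_eq_add_neg] at h2
  rw [Nat.add_sub_cancel]
  generalize (X + lam • N) ^ (m + 1) = A' at *
  generalize (X - lam • N) ^ (m + 1) = B' at *
  generalize (X + lam • N) ^ m = A at *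
  generalize (X - lam • N) ^ m = B at *
  simp only [mul_add, add_mul, mul_smul_comm, smul_mul_assoc]
  rw [add_sub_add_comm, add_sub_add_comm, ← smul_sub, ← smul_sub, ← smul_sub, ← smul_sub, h1, h2]
end

section
/- Let X be a real symmetric n×n matrix and N a real skew-symmetric n×n matrix. For λ ∈ ℝ and k ≥ 1 set G_k^λ := (1/2)(X + λN)^{k−1} + (1/2)(X − λN)^{k−1}. Then for all real λ, μ and all integers k, l ≥ 1, trace( G_k^λ · (X G_l^μ N − N G_l^μ X) ) = 0 and trace( G_k^λ · (G_l^μ N − N G_l^μ) ) = 0. In other words, the functions h_k^λ(X) = (1/k) trace((X + λN)^k) are pairwise in involution (for all values of the parameter) with respect to both the Lie–Poisson bracket with tensor B_X(Y) = XYN − NYX and the frozen bracket with tensor C_X(Y) = YN − NY; hence all the coefficient integrals h_{k,2r} of the system Ẋ = [X², N] are in involution with respect to both Poisson structures. -/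
open Matrix

lemma aux18 {n : ℕ} (N X : Matrix (Fin n) (Fin n) ℝ) (a b : ℝ) (p q : ℕ) :
    ((X + a • N) ^ p * (X * (X + b • N) ^ q * N - N * (X + b • N) ^ q * X)).trace = 0 ∧
    ((X + a • N) ^ p * ((X + b • N) ^ q * N - N * (X + b • N) ^ q)).trace = 0 := by
  have hA : (X + a • N) ^ p * (X + a • N) = (X + a • N) * (X + a • N) ^ p :=
    ((Commute.refl (X + a • N)).pow_left p).eq
  have hB : (X + b • N) ^ q * (X + b • N) = (X + b • N) * (X + b • N) ^ q :=
    ((Commute.refl (X + b • N)).pow_left q).eq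
  have hAB : a = b → (X + a • N) ^ p * (X + b • N) ^ q = (X + b • N) ^ q * (X + a • N) ^ p := by
    rintro rfl
    exact (((Commute.refl (X + a • N)).pow_left p).pow_right q).eq
  generalize (X + a • N) ^ p = A at *
  generalize (X + b • N) ^ q = B at *
  by_cases hab : a = b
  · have h := hAB hab
    subst hab
    constructor
    · have e : A * (X * B * N - N * B * X)
          = A * (X + a • N) * B * N - A * N * (B * (X + a • N)) := by
        simp only [mul_add, add_mul, mul_sub, sub_mul, smul_mul_assoc, mul_smul_comm, mul_assoc]
        abel
      have e2 : A * (X + a • N) * B = B * (X + a • N) * A := by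
        rw [hA, mul_assoc, h, ← mul_assoc, ← hB]
      rw [e, trace_sub, trace_mul_comm (A * N), ← mul_assoc, ← e2, sub_self]
    · rw [mul_sub, trace_sub, ← mul_assoc, ← mul_assoc, trace_mul_comm (A * N), ← mul_assoc, h,
        sub_self]
  · have hne : b - a ≠ 0 := sub_ne_zero.mpr (Ne.symm hab)
    constructor
    · have e : (b - a) • (A * (X * B * N - N * B * X))
          = A * (X + a • N) * (B * (X + b • N)) - A * ((X + b • N) * B) * (X + a • N) := by
        simp only [mul_add, add_mul, mul_sub, smul_mul_assoc, mul_smul_comm, mul_assoc]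
        module
      have t := congrArg trace e
      rw [trace_sub, trace_smul, trace_mul_comm (A * _) (X + a • N), ← mul_assoc (X + a • N),
        hA, hB, sub_self, smul_eq_mul] at t
      exact (mul_eq_zero.mp t).resolve_left hne
    · have e : (b - a) • (A * (B * N - N * B))
          = (A * (B * (X + b • N)) - A * ((X + b • N) * B))
            - (A * B * (X + a • N) - A * (X + a • N) * B) := by
        simp only [mul_add, add_mul, mul_sub, smul_mul_assoc, mul_smul_comm, mul_assoc]
        module
      have t := congrArg trace e
      rw [hB, sub_self, zero_sub, trace_neg, trace_sub, trace_smul,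
        trace_mul_comm (A * B) (X + a • N), ← mul_assoc (X + a • N),
        hA, sub_self, smul_eq_mul, neg_zero] at t
      exact (mul_eq_zero.mp t).resolve_left hne


/-- Involution: for symmetric `X`, skew-symmetric `N`, and
`G_k^λ = (1/2)(X+λN)^{k−1} + (1/2)(X−λN)^{k−1}` (the gradient of
`h_k^λ(X) = (1/k) trace((X+λN)^k)`), for all `λ, μ ∈ ℝ` and `k, l ≥ 1`:
`trace(G_k^λ (X G_l^μ N − N G_l^μ X)) = 0` and
`trace(G_k^λ (G_l^μ N − N G_l^μ)) = 0`; i.e. the functions `h_k^λ` are in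
involution with respect to both the Lie–Poisson tensor `B_X(Y) = XYN − NYX`
and the frozen tensor `C_X(Y) = YN − NY`, hence so are all the coefficient
integrals `h_{k,2r}` of the system `Ẋ = [X², N]`. -/
theorem stmt18 (n : ℕ) (N : Matrix (Fin n) (Fin n) ℝ) (hN : Nᵀ = -N)
    (X : Matrix (Fin n) (Fin n) ℝ) (hX : X.IsSymm)
    (lam mu : ℝ) (k l : ℕ) (hk : 1 ≤ k) (hl : 1 ≤ l) :
    (((1 / 2 : ℝ) • (X + lam • N) ^ (k - 1)
          + (1 / 2 : ℝ) • (X - lam • N) ^ (k - 1))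
        * (X * ((1 / 2 : ℝ) • (X + mu • N) ^ (l - 1)
              + (1 / 2 : ℝ) • (X - mu • N) ^ (l - 1)) * N
           - N * ((1 / 2 : ℝ) • (X + mu • N) ^ (l - 1)
              + (1 / 2 : ℝ) • (X - mu • N) ^ (l - 1)) * X)).trace = 0 ∧
    (((1 / 2 : ℝ) • (X + lam • N) ^ (k - 1)
          + (1 / 2 : ℝ) • (X - lam • N) ^ (k - 1))
        * (((1 / 2 : ℝ) • (X + mu • N) ^ (l - 1)
              + (1 / 2 : ℝ) • (X - mu • N) ^ (l - 1)) * N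
           - N * ((1 / 2 : ℝ) • (X + mu • N) ^ (l - 1)
              + (1 / 2 : ℝ) • (X - mu • N) ^ (l - 1)))).trace = 0 := by
  have h1 := aux18 N X lam mu (k - 1) (l - 1)
  have h2 := aux18 N X lam (-mu) (k - 1) (l - 1)
  have h3 := aux18 N X (-lam) mu (k - 1) (l - 1)
  have h4 := aux18 N X (-lam) (-mu) (k - 1) (l - 1)
  simp only [neg_smul, ← sub_eq_add_neg] at h1 h2 h3 h4
  generalize (X + lam • N) ^ (k - 1) = A at *
  generalize (X - lam • N) ^ (k - 1) = A' at *
  generalize (X + mu • N) ^ (l - 1) = B at *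
  generalize (X - mu • N) ^ (l - 1) = B' at *
  obtain ⟨h1, g1⟩ := h1
  obtain ⟨h2, g2⟩ := h2
  obtain ⟨h3, g3⟩ := h3
  obtain ⟨h4, g4⟩ := h4
  simp only [mul_add, add_mul, mul_sub, smul_mul_assoc, mul_smul_comm, mul_assoc, trace_add,
    trace_sub, trace_smul, smul_eq_mul, smul_add, smul_sub] at *
  constructor <;> linarith
end
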